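/- arXiv:2512.10703 — 9 statements merged into one kernel-verified Lean document; each statement's English description precedes it below -/
import Mathlib

section
/- Let J be a positive integer, let L be a J×J complex matrix satisfying L·Lᴴ ≥ I (i.e. L·Lᴴ − I is positive semidefinite), and let O be a J×J positive semidefinite Hermitian matrix. Denote by o₁↓ ≥ o₂↓ ≥ … ≥ o_J↓ the eigenvalues of O in descending order and by o′₁↓ ≥ … ≥ o′_J↓ the eigenvalues of L·O·Lᴴ in descending order. Then for every j ∈ {1,…,J}, o′_j↓ ≥ o_j↓. -/
open Matrix ComplexOrder

/-- The values of a finite real tuple rearranged in descending order. -/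
noncomputable def descSort {J : ℕ} (f : Fin J → ℝ) : Fin J → ℝ :=
  fun j => f (Tuple.sort f j.rev)

section

variable {𝕜 E F ι : Type*} [RCLike 𝕜] [NormedAddCommGroup E] [InnerProductSpace 𝕜 E]
  [NormedAddCommGroup F] [InnerProductSpace 𝕜 F]

/-- Fewer than `dim E` orthogonality conditions have a common nonzero solution. -/
lemma exists_ne_zero_inner_map_eq_zero_inner_eq_zero [Fintype ι] [LinearOrder ι]
    [FiniteDimensional 𝕜 E] (hE : Module.finrank 𝕜 E = Fintype.card ι) (T : E →ₗ[𝕜] F)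
    (u : ι → F) (v : ι → E) (m : ι) :
    ∃ y : E, y ≠ 0 ∧ (∀ i < m, inner 𝕜 (u i) (T y) = 0) ∧ ∀ i > m, inner 𝕜 (v i) y = 0 := by
  let f : E →ₗ[𝕜] ({i // i ≠ m} → 𝕜) := LinearMap.pi fun i =>
    if i.1 < m then (innerₛₗ 𝕜 (u i)) ∘ₗ T else innerₛₗ 𝕜 (v i)
  have hf : f.ker ≠ ⊥ := by
    apply LinearMap.ker_ne_bot_of_finrank_lt
    rw [Module.finrank_fintype_fun_eq_card, hE]
    exact Fintype.card_subtype_lt (x := m) (by simp)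
  obtain ⟨y, hy, hy0⟩ := Submodule.exists_mem_ne_zero_of_ne_bot hf
  have hfy (i : ι) (hi : i ≠ m) : f y ⟨i, hi⟩ = 0 := congrFun hy ⟨i, hi⟩
  refine ⟨y, hy0, fun i hi => ?_, fun i hi => ?_⟩
  · simpa [f, hi] using hfy i hi.ne
  · simpa [f, hi.not_gt] using hfy i hi.ne'

lemma LinearMap.IsSymmetric.re_inner_map_self_eq_sum [Fintype ι] {T : E →ₗ[𝕜] E}
    (hT : T.IsSymmetric) (b : OrthonormalBasis ι 𝕜 E) {μ : ι → ℝ}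
    (hb : ∀ i, T (b i) = (μ i : 𝕜) • b i) (x : E) :
    RCLike.re (inner 𝕜 x (T x)) = ∑ i, μ i * ‖inner 𝕜 (b i) x‖ ^ 2 := by
  rw [← b.sum_inner_mul_inner, map_sum]
  refine Finset.sum_congr rfl fun i _ => ?_
  rw [← hT, hb, inner_smul_left, RCLike.conj_ofReal, mul_left_comm, RCLike.re_ofReal_mul,
    ← inner_conj_symm x (b i), RCLike.conj_mul, ← RCLike.ofReal_pow, RCLike.ofReal_re]

lemma LinearMap.IsSymmetric.mul_norm_sq_le_re_inner_map_self [Fintype ι] {T : E →ₗ[𝕜] E}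
    (hT : T.IsSymmetric) (b : OrthonormalBasis ι 𝕜 E) {μ : ι → ℝ}
    (hb : ∀ i, T (b i) = (μ i : 𝕜) • b i) {c : ℝ} {x : E}
    (hx : ∀ i, μ i < c → inner 𝕜 (b i) x = 0) :
    c * ‖x‖ ^ 2 ≤ RCLike.re (inner 𝕜 x (T x)) := by
  rw [hT.re_inner_map_self_eq_sum b hb, ← b.sum_sq_norm_inner_right, Finset.mul_sum]
  refine Finset.sum_le_sum fun i _ => ?_
  rcases lt_or_ge (μ i) c with h | h
  · simp [hx i h]
  · gcongr

lemma LinearMap.IsSymmetric.re_inner_map_self_le_mul_norm_sq [Fintype ι] {T : E →ₗ[𝕜] E}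
    (hT : T.IsSymmetric) (b : OrthonormalBasis ι 𝕜 E) {μ : ι → ℝ}
    (hb : ∀ i, T (b i) = (μ i : 𝕜) • b i) {c : ℝ} {x : E}
    (hx : ∀ i, c < μ i → inner 𝕜 (b i) x = 0) :
    RCLike.re (inner 𝕜 x (T x)) ≤ c * ‖x‖ ^ 2 := by
  rw [hT.re_inner_map_self_eq_sum b hb, ← b.sum_sq_norm_inner_right, Finset.mul_sum]
  refine Finset.sum_le_sum fun i _ => ?_
  rcases lt_or_ge c (μ i) with h | h
  · simp [hx i h]
  · gcongr

end

lemma Matrix.IsHermitian.toEuclideanLin_eigenvectorBasis {𝕜 n : Type*} [RCLike 𝕜] [Fintype n]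
    [DecidableEq n] {A : Matrix n n 𝕜} (hA : A.IsHermitian) (i : n) :
    A.toEuclideanLin (hA.eigenvectorBasis i) =
      (hA.eigenvalues i : 𝕜) • hA.eigenvectorBasis i := by
  ext k
  simpa [RCLike.real_smul_eq_coe_mul] using congrFun (hA.mulVec_eigenvectorBasis i) k

lemma Matrix.toEuclideanLin_mul_apply {𝕜 l m n : Type*} [RCLike 𝕜] [Fintype m] [DecidableEq m]
    [Fintype n] [DecidableEq n] (A : Matrix l m 𝕜) (B : Matrix m n 𝕜)
    (x : EuclideanSpace 𝕜 n) :
    (A * B).toEuclideanLin x = A.toEuclideanLin (B.toEuclideanLin x) := by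
  ext
  simp [Matrix.mulVec_mulVec]

lemma Matrix.inner_toEuclideanLin_right {𝕜 m n : Type*} [RCLike 𝕜] [Fintype m] [DecidableEq m]
    [Fintype n] [DecidableEq n] (A : Matrix m n 𝕜) (x : EuclideanSpace 𝕜 m)
    (y : EuclideanSpace 𝕜 n) :
    inner 𝕜 x (A.toEuclideanLin y) = inner 𝕜 (Aᴴ.toEuclideanLin x) y := by
  rw [Matrix.toEuclideanLin_conjTranspose_eq_adjoint, LinearMap.adjoint_inner_left]

lemma norm_le_norm_toEuclideanLin_conjTranspose {𝕜 n : Type*} [RCLike 𝕜] [Fintype n]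
    [DecidableEq n] {L : Matrix n n 𝕜} (hL : (L * Lᴴ - 1).PosSemidef) (x : EuclideanSpace 𝕜 n) :
    ‖x‖ ≤ ‖Lᴴ.toEuclideanLin x‖ := by
  have h := (Matrix.isPositive_toEuclideanLin_iff.mpr hL).re_inner_nonneg_right x
  have h1 : (1 : Matrix n n 𝕜).toEuclideanLin x = x := by ext; simp
  rw [map_sub, LinearMap.sub_apply, inner_sub_right, Matrix.toEuclideanLin_mul_apply,
    Matrix.inner_toEuclideanLin_right, h1, map_sub, inner_self_eq_norm_sq,
    inner_self_eq_norm_sq, sub_nonneg] at h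
  exact (sq_le_sq₀ (norm_nonneg _) (norm_nonneg _)).mp h

lemma lt_of_apply_sort_lt {J : ℕ} {α : Type*} [LinearOrder α] {f : Fin J → α} {i m : Fin J}
    (h : f (Tuple.sort f i) < f (Tuple.sort f m)) : i < m :=
  (Tuple.monotone_sort f).reflect_lt h

/-- If `L * Lᴴ ≥ I` and `O` is positive semidefinite, then every eigenvalue (in descending
order) of `L * O * Lᴴ` dominates the corresponding eigenvalue of `O`. -/
theorem eigenvalues_conj_ge (J : ℕ) (hJ : 0 < J) (L O : Matrix (Fin J) (Fin J) ℂ)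
    (hL : (L * Lᴴ - 1).PosSemidef) (hO : O.PosSemidef) :
    ∀ j : Fin J,
      descSort hO.1.eigenvalues j ≤
        descSort (hO.mul_mul_conjTranspose_same L).1.eigenvalues j := by
  intro j
  have hB := hO.mul_mul_conjTranspose_same L
  by_contra! hlt
  set c := descSort hO.1.eigenvalues j
  set d := descSort hB.1.eigenvalues j
  have hd0 : 0 ≤ d := hB.eigenvalues_nonneg _
  let σ := Tuple.sort hO.1.eigenvalues
  let τ := Tuple.sort hB.1.eigenvalues
  obtain ⟨y, hy0, hyO, hyB⟩ := exists_ne_zero_inner_map_eq_zero_inner_eq_zero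
    (ι := Fin J) (by simp) Lᴴ.toEuclideanLin
    (fun i => hO.1.eigenvectorBasis (σ i)) (fun i => hB.1.eigenvectorBasis (τ i)) j.rev
  have lower := (Matrix.isSymmetric_toEuclideanLin_iff.mpr
    hO.1).mul_norm_sq_le_re_inner_map_self hO.1.eigenvectorBasis
    hO.1.toEuclideanLin_eigenvectorBasis (c := c) (x := Lᴴ.toEuclideanLin y) fun i hi => by
      obtain ⟨k, rfl⟩ := σ.surjective i
      exact hyO k (lt_of_apply_sort_lt hi)
  have upper := (Matrix.isSymmetric_toEuclideanLin_iff.mpr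
    hB.1).re_inner_map_self_le_mul_norm_sq hB.1.eigenvectorBasis
    hB.1.toEuclideanLin_eigenvectorBasis (c := d) (x := y) fun i hi => by
      obtain ⟨k, rfl⟩ := τ.surjective i
      exact hyB k (lt_of_apply_sort_lt (f := hB.1.eigenvalues) hi)
  rw [Matrix.mul_assoc, Matrix.toEuclideanLin_mul_apply, Matrix.toEuclideanLin_mul_apply,
    Matrix.inner_toEuclideanLin_right] at upper
  have hpos : 0 < ‖y‖ ^ 2 := by positivity
  have : c * ‖y‖ ^ 2 ≤ d * ‖y‖ ^ 2 :=
    calc c * ‖y‖ ^ 2 ≤ c * ‖Lᴴ.toEuclideanLin y‖ ^ 2 := by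
          have := hd0.trans hlt.le
          gcongr
          exact norm_le_norm_toEuclideanLin_conjTranspose hL y
      _ ≤ d * ‖y‖ ^ 2 := lower.trans upper
  exact hlt.not_ge (le_of_mul_le_mul_right this hpos)
end

section
/- Let J be a positive integer, let L be a J×J complex matrix satisfying L·Lᴴ ≥ I, and let O be a J×J positive semidefinite Hermitian matrix with eigenvalues o₁↓ ≥ … ≥ o_J↓ in descending order. Let o″_j = (L·O·Lᴴ)_{jj} denote the diagonal entries of L·O·Lᴴ. Then for every k ∈ {1,…,J}, ∑_{j=k}^{J} o″_j ≥ ∑_{j=k}^{J} o_j↓. -/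
open Matrix ComplexOrder

/-- A weighted sum with weights in `[0, 1]` of total mass `#(Ici k)` dominates the sum of the
smallest `#(Ici k)` values. -/
theorem sum_Ici_descSort_le {J : ℕ} (f q : Fin J → ℝ) (k : Fin J) (hq0 : ∀ i, 0 ≤ q i)
    (hq1 : ∀ i, q i ≤ 1) (hq : ∑ i, q i = (Finset.Ici k).card) :
    ∑ j ∈ Finset.Ici k, descSort f j ≤ ∑ i, f i * q i := by
  have hanti : Antitone (descSort f) := fun a b hab =>
    Tuple.monotone_sort f (Fin.rev_le_rev.mpr hab)
  let σ : Equiv.Perm (Fin J) := Fin.revPerm.trans (Tuple.sort f)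
  have hsum : ∑ i, f i * q i = ∑ j, descSort f j * q (σ j) :=
    (Equiv.sum_comp σ fun i => f i * q i).symm
  have hmass : ∑ j, q (σ j) = (Finset.Ici k).card := by rw [Equiv.sum_comp σ q, hq]
  have hterm : ∀ j, descSort f k * (q (σ j) - if j ∈ Finset.Ici k then 1 else 0) ≤
      descSort f j * (q (σ j) - if j ∈ Finset.Ici k then 1 else 0) := by
    intro j
    split_ifs with hj
    · nlinarith [hanti (Finset.mem_Ici.mp hj), hq1 (σ j)]
    · nlinarith [hanti (not_le.mp (mt Finset.mem_Ici.mpr hj)).le, hq0 (σ j)]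
  have hle := Finset.sum_le_sum fun j (_ : j ∈ Finset.univ) => hterm j
  rw [← Finset.mul_sum, Finset.sum_sub_distrib, hmass] at hle
  simp only [mul_sub, Finset.sum_sub_distrib, mul_ite, mul_one, mul_zero, Finset.sum_ite_mem,
    Finset.univ_inter, Finset.sum_const, nsmul_eq_mul] at hle
  linarith

/-- If `1 ≤ A` in the Loewner order then `A⁻¹ ≤ 1`. -/
theorem Matrix.posSemidef_one_sub_inv {m : Type*} [Fintype m] [DecidableEq m]
    {A : Matrix m m ℂ} (hA : (A - 1).PosSemidef) : IsUnit A.det ∧ (1 - A⁻¹).PosSemidef := by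
  have hpos : A.PosDef := by simpa using PosDef.posSemidef_add hA PosDef.one
  have hdet : IsUnit A.det := (isUnit_iff_isUnit_det A).mp hpos.isUnit
  refine ⟨hdet, ?_⟩
  have hsq : ((A - 1)ᴴ * (A - 1) + (A - 1)).PosSemidef :=
    (posSemidef_conjTranspose_mul_self _).add hA
  have h := hsq.conjTranspose_mul_mul_same A⁻¹
  rw [hA.1.eq, hpos.1.inv.eq] at h
  convert h using 1
  have e : (A - 1) * (A - 1) + (A - 1) = A * A - A := by noncomm_ring
  rw [e, mul_sub, sub_mul, nonsing_inv_mul _ hdet, one_mul, ← mul_assoc,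
    nonsing_inv_mul _ hdet, one_mul, mul_nonsing_inv _ hdet]

/-- If `1 ≤ M * Mᴴ`, the diagonal `q` of the orthogonal projection onto the row space of `M` is a
family of weights in `[0, 1]`, of total mass the number of rows, dominated by the diagonal of
`Mᴴ * M`. -/
theorem Matrix.exists_weights_le_diag_conjTranspose_mul_self {m n : Type*} [Fintype m]
    [DecidableEq m] [Fintype n] [DecidableEq n] (M : Matrix m n ℂ)
    (hM : (M * Mᴴ - 1).PosSemidef) :
    ∃ q : n → ℝ, (∀ i, 0 ≤ q i) ∧ (∀ i, q i ≤ 1) ∧ (∀ i, q i ≤ ((Mᴴ * M) i i).re) ∧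
      ∑ i, q i = Fintype.card m := by
  obtain ⟨hdet, hinv⟩ := posSemidef_one_sub_inv hM
  set A := M * Mᴴ with hAdef
  have hAinv : (A⁻¹)ᴴ = A⁻¹ := (isHermitian_mul_conjTranspose_self M).inv.eq
  set Q := Mᴴ * A⁻¹ * M with hQdef
  have hQh : Qᴴ = Q := by
    simp only [hQdef, conjTranspose_mul, conjTranspose_conjTranspose, hAinv, Matrix.mul_assoc]
  have hQQ : Q * Q = Q := by
    calc Q * Q = Mᴴ * (A⁻¹ * A) * A⁻¹ * M := by simp only [hQdef, hAdef, Matrix.mul_assoc]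
      _ = Q := by rw [nonsing_inv_mul _ hdet, Matrix.mul_one]
  have hQ0 : Q.PosSemidef := by
    have h := posSemidef_conjTranspose_mul_self Q
    rwa [hQh, hQQ] at h
  have hQ1 : (1 - Q).PosSemidef := by
    have h := posSemidef_conjTranspose_mul_self (1 - Q)
    rwa [conjTranspose_sub, hQh, conjTranspose_one, mul_sub, sub_mul, sub_mul, hQQ, mul_one,
      one_mul, mul_one, sub_self, sub_zero] at h
  have hQM : (Mᴴ * M - Q).PosSemidef := by
    have h := hinv.conjTranspose_mul_mul_same M
    rwa [Matrix.mul_sub, Matrix.sub_mul, Matrix.mul_one] at h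
  refine ⟨fun i => (Q i i).re, fun i => ?_, fun i => ?_, fun i => ?_, ?_⟩
  · exact (Complex.le_def.mp (hQ0.diag_nonneg (i := i))).1
  · have h := (Complex.le_def.mp (hQ1.diag_nonneg (i := i))).1
    simpa using h
  · have h := (Complex.le_def.mp (hQM.diag_nonneg (i := i))).1
    simpa using h
  · have h : Q.trace = Fintype.card m := by
      rw [hQdef, Matrix.mul_assoc, trace_mul_comm, Matrix.mul_assoc, ← hAdef,
        nonsing_inv_mul _ hdet, trace_one]
    simpa [trace] using congrArg Complex.re h

/-- The trace of `M * diagonal d * Mᴴ` in terms of the diagonal of `Mᴴ * M`. -/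
theorem Matrix.re_trace_mul_diagonal_mul_conjTranspose {m n : Type*} [Fintype m] [Fintype n]
    [DecidableEq n] (M : Matrix m n ℂ) (d : n → ℝ) :
    (M * diagonal (fun i => (d i : ℂ)) * Mᴴ).trace.re = ∑ i, d i * ((Mᴴ * M) i i).re := by
  rw [Matrix.mul_assoc, trace_mul_comm, Matrix.mul_assoc, trace]
  simp [diagonal_mul]

/-- If `L * Lᴴ ≥ I` and `O` is positive semidefinite with eigenvalues `o₁↓ ≥ … ≥ o_J↓`,
then every tail sum of the diagonal entries of `L * O * Lᴴ` dominates the corresponding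
tail sum of the descending eigenvalues of `O`. -/
theorem tail_sum_diag_conj_ge (J : ℕ) (hJ : 0 < J) (L O : Matrix (Fin J) (Fin J) ℂ)
    (hL : (L * Lᴴ - 1).PosSemidef) (hO : O.PosSemidef) :
    ∀ k : Fin J,
      ∑ j ∈ Finset.Ici k, descSort hO.1.eigenvalues j ≤
        ∑ j ∈ Finset.Ici k, ((L * O * Lᴴ) j j).re := by
  intro k
  set U : Matrix (Fin J) (Fin J) ℂ := hO.1.eigenvectorUnitary.1
  set D : Matrix (Fin J) (Fin J) ℂ := diagonal fun i => (hO.1.eigenvalues i : ℂ)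
  have hspec : O = U * D * Uᴴ := hO.1.spectral_theorem
  have hUU : U * Uᴴ = 1 := Unitary.coe_mul_star_self hO.1.eigenvectorUnitary
  let r : Finset.Ici k → Fin J := Subtype.val
  set M : Matrix (Finset.Ici k) (Fin J) ℂ := (L * U).submatrix r id with hMdef
  have hsub (X : Matrix (Fin J) (Fin J) ℂ) :
      M * X * Mᴴ = (L * (U * X * Uᴴ) * Lᴴ).submatrix r r := by
    rw [hMdef, conjTranspose_submatrix, ← submatrix_id_id X,
      ← submatrix_mul _ _ _ _ _ Function.bijective_id,
      ← submatrix_mul _ _ _ _ _ Function.bijective_id]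
    simp only [conjTranspose_mul, Matrix.mul_assoc, submatrix_id_id]
  have hM : (M * Mᴴ - 1).PosSemidef := by
    have h := hsub 1
    rw [Matrix.mul_one, mul_one, hUU, mul_one] at h
    rw [h, ← submatrix_one r Subtype.val_injective]
    exact hL.submatrix r
  obtain ⟨q, hq0, hq1, hqM, hq⟩ := M.exists_weights_le_diag_conjTranspose_mul_self hM
  calc ∑ j ∈ Finset.Ici k, descSort hO.1.eigenvalues j
      ≤ ∑ i, hO.1.eigenvalues i * q i :=
        sum_Ici_descSort_le _ q k hq0 hq1 (by rw [hq, Fintype.card_coe])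
    _ ≤ ∑ i, hO.1.eigenvalues i * ((Mᴴ * M) i i).re :=
        Finset.sum_le_sum fun i _ => mul_le_mul_of_nonneg_left (hqM i) (hO.eigenvalues_nonneg i)
    _ = (M * D * Mᴴ).trace.re := (M.re_trace_mul_diagonal_mul_conjTranspose _).symm
    _ = ∑ j ∈ Finset.Ici k, ((L * O * Lᴴ) j j).re := by
        rw [hsub, ← hspec, ← Finset.sum_coe_sort, trace, Complex.re_sum]
        rfl
end

section
/- Let J be a positive integer, and let C and S be J×J complex matrices satisfying C·Cᴴ − conj(S·Sᴴ) = I (the defining condition on the linear part of a multimode Gaussian unitary). Let μ₁, …, μ_J be positive reals, let μ↓ denote this tuple sorted in descending order, and define μ′_j = ∑_{j'=1}^{J} (|C_{j j'}|² + |S_{j j'}|²) μ_{j'}. Then for every k ∈ {1,…,J}, ∑_{j=k}^{J} μ′_j ≥ ∑_{j=k}^{J} μ_j↓. Moreover, equality holds for all k simultaneously when S = 0 and C is the permutation matrix that puts the μ_j in descending order. -/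
open Matrix

open scoped ComplexOrder in
/-- If `A * Aᴴ` dominates the identity, the diagonal of the orthogonal projection onto the row
space of `A` has entries in `[0, 1]`, is dominated by the diagonal of `Aᴴ * A`, and sums to the
number of rows. -/
theorem exists_weights_of_mul_conjTranspose_eq_one_add {m n l : Type*} [Fintype m] [DecidableEq m]
    [Fintype n] [DecidableEq n] [Fintype l] (A : Matrix m n ℂ) (B : Matrix m l ℂ)
    (h : A * Aᴴ = 1 + B * Bᴴ) :
    ∃ p : n → ℝ, (∀ j, 0 ≤ p j) ∧ (∀ j, p j ≤ 1) ∧ (∀ j, p j ≤ ∑ i, ‖A i j‖ ^ 2) ∧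
      ∑ j, p j = Fintype.card m := by
  set G := A * Aᴴ with hG
  have hB : (B * Bᴴ).PosSemidef := posSemidef_self_mul_conjTranspose B
  have hGpos : G.PosDef := by
    rw [h]
    exact PosDef.one.add_posSemidef hB
  have hdet : IsUnit G.det := (isUnit_iff_isUnit_det G).mp hGpos.isUnit
  have hGi : (G⁻¹)ᴴ = G⁻¹ := hGpos.isHermitian.inv
  have hl : G⁻¹ * G = 1 := nonsing_inv_mul G hdet
  have hr : G * G⁻¹ = 1 := mul_nonsing_inv G hdet
  set P := Aᴴ * G⁻¹ * A with hP
  have hPP : P * P = P := by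
    calc P * P = Aᴴ * (G⁻¹ * G) * G⁻¹ * A := by simp only [hP, hG, Matrix.mul_assoc]
      _ = P := by rw [hl, Matrix.mul_one]
  have hPh : Pᴴ = P := by
    simp [hP, conjTranspose_mul, hGi, Matrix.mul_assoc]
  have hP0 : P.PosSemidef := by
    have := posSemidef_conjTranspose_mul_self P
    rwa [hPh, hPP] at this
  have hP1 : (1 - P).PosSemidef := by
    have := posSemidef_conjTranspose_mul_self (1 - P)
    rwa [conjTranspose_sub, conjTranspose_one, hPh, Matrix.sub_mul, Matrix.one_mul,
      Matrix.mul_sub, Matrix.mul_one, hPP, sub_self, sub_zero] at this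
  have hinv : (1 - G⁻¹).PosSemidef := by
    have hsum : (B * Bᴴ + (B * Bᴴ)ᴴ * (B * Bᴴ)).PosSemidef :=
      hB.add (posSemidef_conjTranspose_mul_self _)
    have hconj := hsum.conjTranspose_mul_mul_same G⁻¹
    have hBG : B * Bᴴ = G - 1 := by rw [h]; abel
    have heq : (G⁻¹)ᴴ * (B * Bᴴ + (B * Bᴴ)ᴴ * (B * Bᴴ)) * G⁻¹ = 1 - G⁻¹ := by
      rw [hB.isHermitian.eq, hGi, hBG]
      have : G - 1 + (G - 1) * (G - 1) = G * (G - 1) := by noncomm_ring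
      rw [this, ← Matrix.mul_assoc, hl, Matrix.one_mul, Matrix.sub_mul, hr, Matrix.one_mul]
    rwa [heq] at hconj
  have hAP : (Aᴴ * A - P).PosSemidef := by
    have := hinv.conjTranspose_mul_mul_same A
    rwa [Matrix.mul_sub, Matrix.mul_one, Matrix.sub_mul] at this
  have hdiag : ∀ {M : Matrix n n ℂ}, M.PosSemidef → ∀ j, 0 ≤ (M j j).re := fun hM j =>
    (Complex.le_def.mp (hM.diag_nonneg (i := j))).1
  refine ⟨fun j => (P j j).re, hdiag hP0, fun j => ?_, fun j => ?_, ?_⟩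
  · simpa using hdiag hP1 j
  · have hre : ((Aᴴ * A) j j).re = ∑ i, ‖A i j‖ ^ 2 := by
      simp only [mul_apply, conjTranspose_apply, Complex.re_sum]
      refine Finset.sum_congr rfl fun i _ => ?_
      rw [Complex.star_def, Complex.conj_mul', ← Complex.ofReal_pow, Complex.ofReal_re]
    have := hdiag hAP j
    rw [Matrix.sub_apply, Complex.sub_re, hre] at this
    linarith
  · have htr : P.trace = Fintype.card m := by
      rw [hP, Matrix.mul_assoc, trace_mul_comm, Matrix.mul_assoc, ← hG, hl, trace_one]
    have := congrArg Complex.re htr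
    simpa [trace, Complex.re_sum] using this

theorem descSort_antitone {J : ℕ} (f : Fin J → ℝ) : Antitone (descSort f) := fun _ _ hab =>
  Tuple.monotone_sort f (Fin.rev_le_rev.mpr hab)

/-- A weighted sum with weights in `[0, 1]` of total mass `#(Ici k)` is at least the sum of the
`#(Ici k)` smallest values. -/
theorem sum_Ici_descSort_le_sum_mul {J : ℕ} (μ p : Fin J → ℝ) (k : Fin J) (hp0 : ∀ j, 0 ≤ p j)
    (hp1 : ∀ j, p j ≤ 1) (hp : ∑ j, p j = (Finset.Ici k).card) :
    ∑ j ∈ Finset.Ici k, descSort μ j ≤ ∑ j, p j * μ j := by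
  let e : Equiv.Perm (Fin J) := Fin.revPerm.trans (Tuple.sort μ)
  have hcard : ∑ j, (if k ≤ j then (1 : ℝ) else 0) = (Finset.Ici k).card := by
    rw [Finset.sum_boole]
    congr 2
    ext
    simp
  have hsum : ∑ j, p (e j) = (Finset.Ici k).card := (Equiv.sum_comp e p).trans hp
  have htail : ∑ j ∈ Finset.Ici k, descSort μ j =
      ∑ j, (if k ≤ j then (1 : ℝ) else 0) * descSort μ j := by
    simp only [ite_mul, one_mul, zero_mul, ← Finset.sum_filter]
    exact Finset.sum_congr (by ext; simp) fun _ _ => rfl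
  have hre : ∑ j, p j * μ j = ∑ j, p (e j) * descSort μ j :=
    (Equiv.sum_comp e fun j => p j * μ j).symm
  have hterm : 0 ≤ ∑ j, (p (e j) - if k ≤ j then 1 else 0) * (descSort μ j - descSort μ k) := by
    refine Finset.sum_nonneg fun j _ => ?_
    split_ifs with hkj
    · exact mul_nonneg_of_nonpos_of_nonpos (by linarith [hp1 (e j)])
        (by linarith [descSort_antitone μ hkj])
    · exact mul_nonneg (by linarith [hp0 (e j)])
        (by linarith [descSort_antitone μ (not_le.mp hkj).le])
  have hexpand : ∑ j, (p (e j) - if k ≤ j then 1 else 0) * (descSort μ j - descSort μ k) =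
      (∑ j, p (e j) * descSort μ j - ∑ j, (if k ≤ j then (1 : ℝ) else 0) * descSort μ j) -
      (∑ j, p (e j) - ∑ j, if k ≤ j then (1 : ℝ) else 0) * descSort μ k := by
    rw [← Finset.sum_sub_distrib, ← Finset.sum_sub_distrib, Finset.sum_mul,
      ← Finset.sum_sub_distrib]
    exact Finset.sum_congr rfl fun j _ => by ring
  rw [hexpand, hsum, hcard, sub_self, zero_mul, sub_zero] at hterm
  rw [htail, hre]
  linarith

/-- For the linear part `(C, S)` of a multimode Gaussian unitary (so that
`C·Cᴴ − conj(S·Sᴴ) = I`) acting on positive diagonal second moments `μ_j`, the output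
moments `μ′_j = ∑_{j'} (|C_{jj'}|² + |S_{jj'}|²) μ_{j'}` satisfy
`∑_{j=k}^J μ′_j ≥ ∑_{j=k}^J μ_j↓` for every `k`, with equality for all `k` when `S = 0`
and `C` is the permutation matrix putting the `μ_j` in descending order. -/
theorem gaussian_moment_tail_sum (J : ℕ) (hJ : 0 < J) (C S : Matrix (Fin J) (Fin J) ℂ)
    (hCS : C * Cᴴ - (S * Sᴴ).map (starRingEnd ℂ) = 1)
    (μ : Fin J → ℝ) (hμ : ∀ j, 0 < μ j)
    (μ' : Fin J → ℝ)
    (hμ' : ∀ j, μ' j = ∑ j' : Fin J, (‖C j j'‖ ^ 2 + ‖S j j'‖ ^ 2) * μ j') :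
    (∀ k : Fin J, ∑ j ∈ Finset.Ici k, descSort μ j ≤ ∑ j ∈ Finset.Ici k, μ' j) ∧
    (∀ σ : Equiv.Perm (Fin J), S = 0 → C = σ.permMatrix ℂ →
      (∀ j, μ (σ j) = descSort μ j) →
      ∀ k : Fin J, ∑ j ∈ Finset.Ici k, μ' j = ∑ j ∈ Finset.Ici k, descSort μ j) := by
  refine ⟨fun k => ?_, ?_⟩
  · let r : {j // j ∈ Finset.Ici k} → Fin J := Subtype.val
    have h : C.submatrix r id * (C.submatrix r id)ᴴ =
        1 + (S.map (starRingEnd ℂ)).submatrix r id *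
          ((S.map (starRingEnd ℂ)).submatrix r id)ᴴ := by
      have hC : C * Cᴴ = 1 + S.map (starRingEnd ℂ) * (S.map (starRingEnd ℂ))ᴴ := by
        have hS : (S * Sᴴ).map (starRingEnd ℂ) =
            S.map (starRingEnd ℂ) * (S.map (starRingEnd ℂ))ᴴ := by
          ext i j
          simp [mul_apply]
        rw [← hS, ← hCS]
        abel
      have := congrArg (fun M => M.submatrix r r) hC
      simpa [submatrix_mul _ _ r id r Function.bijective_id, submatrix_add,
        submatrix_one r Subtype.val_injective] using this
    obtain ⟨p, hp0, hp1, hpw, hp⟩ := exists_weights_of_mul_conjTranspose_eq_one_add _ _ h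
    rw [Fintype.card_coe] at hp
    refine (sum_Ici_descSort_le_sum_mul μ p k hp0 hp1 hp).trans ?_
    simp only [hμ']
    rw [Finset.sum_comm]
    refine Finset.sum_le_sum fun j' _ => ?_
    rw [← Finset.sum_mul]
    refine mul_le_mul_of_nonneg_right ((hpw j').trans ?_) (hμ j').le
    simp only [submatrix_apply, id_eq, r]
    rw [Finset.sum_coe_sort (Finset.Ici k) fun j => ‖C j j'‖ ^ 2]
    exact Finset.sum_le_sum fun j _ => le_add_of_nonneg_right (sq_nonneg _)
  · rintro σ rfl rfl hσ k
    refine Finset.sum_congr rfl fun j _ => ?_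
    rw [hμ', ← hσ, Finset.sum_eq_single (σ j)]
    · simp [Equiv.Perm.permMatrix, PEquiv.toMatrix_apply]
    · intro j' _ hj'
      simp [Equiv.Perm.permMatrix, PEquiv.toMatrix_apply, hj'.symm]
    · simp
end

section
/- For all real numbers a, b with a ≥ b > 0, the inequality a/b² − (a+1)/(b+1)² + 1/(b·(b+1)) > 0 holds. -/
/-- Positivity of the second partial derivative of the swap-chain entropy production:
for reals `a ≥ b > 0`, `a/b² − (a+1)/(b+1)² + 1/(b(b+1)) > 0`. -/
theorem second_derivative_pos (a b : ℝ) (hb : 0 < b) (hab : b ≤ a) :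
    0 < a / b ^ 2 - (a + 1) / (b + 1) ^ 2 + 1 / (b * (b + 1)) := by
  have ha : 0 < a := hb.trans_le hab
  have h : a / b ^ 2 - (a + 1) / (b + 1) ^ 2 + 1 / (b * (b + 1)) =
      (2 * a * b + a + b) / (b ^ 2 * (b + 1) ^ 2) := by
    field_simp
    ring
  rw [h]
  positivity
end

section
/- Let β > 0, ω₀ > 0, ω₁ > 0 be reals and p ≥ 1 an integer. Set s = 1/(e^{β·ω₀} − 1) and m = 1/(e^{β·ω₁} − 1). Then (1+m)ᵖ·s − mᵖ·(1+s) > 0 if and only if p·ω₁ > ω₀. -/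
theorem one_add_one_div_exp_sub_one {x : ℝ} (hx : 0 < x) :
    1 + 1 / (Real.exp x - 1) = Real.exp x * (1 / (Real.exp x - 1)) := by
  have : Real.exp x - 1 ≠ 0 := (sub_pos.2 (Real.one_lt_exp_iff.2 hx)).ne'
  field_simp
  ring

/-- Sub-bath cooling condition for the `p`-excitation exchange interaction: with
`s = 1/(e^{βω₀} − 1)` and `m = 1/(e^{βω₁} − 1)`, one has
`(1+m)ᵖ·s − mᵖ·(1+s) > 0` if and only if `p·ω₁ > ω₀`. -/
theorem subbath_cooling_condition (β ω₀ ω₁ : ℝ) (hβ : 0 < β) (h0 : 0 < ω₀) (h1 : 0 < ω₁)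
    (p : ℕ) (hp : 1 ≤ p) (s m : ℝ)
    (hs : s = 1 / (Real.exp (β * ω₀) - 1)) (hm : m = 1 / (Real.exp (β * ω₁) - 1)) :
    0 < (1 + m) ^ p * s - m ^ p * (1 + s) ↔ ω₀ < (p : ℝ) * ω₁ := by
  have hs_pos : 0 < s := hs ▸ one_div_pos.2 (sub_pos.2 (Real.one_lt_exp_iff.2 (mul_pos hβ h0)))
  have hm_pos : 0 < m := hm ▸ one_div_pos.2 (sub_pos.2 (Real.one_lt_exp_iff.2 (mul_pos hβ h1)))
  have hs_add : 1 + s = Real.exp (β * ω₀) * s := hs ▸ one_add_one_div_exp_sub_one (mul_pos hβ h0)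
  have hm_add : 1 + m = Real.exp (β * ω₁) * m := hm ▸ one_add_one_div_exp_sub_one (mul_pos hβ h1)
  have factored : (1 + m) ^ p * s - m ^ p * (1 + s) =
      m ^ p * s * (Real.exp (β * (p * ω₁)) - Real.exp (β * ω₀)) := by
    rw [hs_add, hm_add, mul_pow, ← Real.exp_nat_mul, mul_left_comm (p : ℝ) β ω₁]
    ring
  rw [factored, mul_pos_iff_of_pos_left (mul_pos (pow_pos hm_pos p) hs_pos), sub_pos,
    Real.exp_lt_exp, mul_lt_mul_iff_right₀ hβ]
end

section
/- Let β > 0, ω₀ > 0, ω₁ > 0 be reals, p ≥ 1 an integer, and set m = 1/(e^{β·ω₁} − 1). Let κ > 0 be a real number with κ·((1+m)ᵖ − mᵖ) < 2, and let (u_L)_{L∈ℕ} be any sequence of reals satisfying u_L = u_{L−1} − κ·( (1+m)ᵖ·u_{L−1} − mᵖ·(1+u_{L−1}) ) for all L ≥ 1. Then u_L converges as L → ∞ to u_∞ = 1/(e^{p·β·ω₁} − 1). Consequently, if u₀ > 0 so that u_∞ > 0, the effective inverse temperature (1/ω₀)·ln((u_∞+1)/u_∞) equals (ω₁/ω₀)·p·β.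 -/
/-- A real sequence whose deviation from `v` is multiplied by `r` at each step, with `|r| < 1`,
converges to `v`. -/
theorem tendsto_of_sub_succ_eq_mul_sub {u : ℕ → ℝ} {r v : ℝ} (hr : |r| < 1)
    (hu : ∀ n, u (n + 1) - v = r * (u n - v)) :
    Filter.Tendsto u Filter.atTop (nhds v) := by
  have hclosed : ∀ n, u n = r ^ n * (u 0 - v) + v := by
    intro n
    induction n with
    | zero => simp
    | succ n ih =>
      have h := hu n
      rw [ih] at h
      rw [pow_succ]
      linear_combination h
  rw [funext hclosed]
  simpa using ((tendsto_pow_atTop_nhds_zero_of_abs_lt_one hr).mul_const (u 0 - v)).add_const v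

/-- The mean excitation number `n = 1/(eˣ − 1)` satisfies `ln((n+1)/n) = x`. -/
theorem log_one_div_exp_sub_one_add_one_div {x : ℝ} (hx : 0 < x) :
    Real.log ((1 / (Real.exp x - 1) + 1) / (1 / (Real.exp x - 1))) = x := by
  have hne : Real.exp x - 1 ≠ 0 := (sub_pos.mpr (Real.one_lt_exp_iff.mpr hx)).ne'
  have hratio : (1 / (Real.exp x - 1) + 1) / (1 / (Real.exp x - 1)) = Real.exp x := by
    field_simp
    ring
  rw [hratio, Real.log_exp]

/-- Asymptotic cooling limit of iterated `p`-excitation exchange collisions: the sequence of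
mean excitation numbers converges to `u_∞ = 1/(e^{pβω₁} − 1)`, and (when `u₀ > 0`, so that
`u_∞ > 0`) the corresponding effective inverse temperature `(1/ω₀)·ln((u_∞+1)/u_∞)` equals
`(ω₁/ω₀)·p·β`. -/
theorem iterative_cooling_limit (β ω₀ ω₁ : ℝ) (hβ : 0 < β) (h0 : 0 < ω₀) (h1 : 0 < ω₁)
    (p : ℕ) (hp : 1 ≤ p) (m : ℝ) (hm : m = 1 / (Real.exp (β * ω₁) - 1))
    (κ : ℝ) (hκ : 0 < κ) (hκ2 : κ * ((1 + m) ^ p - m ^ p) < 2)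
    (u : ℕ → ℝ)
    (hrec : ∀ L : ℕ, 1 ≤ L →
      u L = u (L - 1) - κ * ((1 + m) ^ p * u (L - 1) - m ^ p * (1 + u (L - 1)))) :
    Filter.Tendsto u Filter.atTop (nhds (1 / (Real.exp ((p : ℝ) * β * ω₁) - 1))) ∧
      (0 < u 0 →
        (1 / ω₀) *
            Real.log ((1 / (Real.exp ((p : ℝ) * β * ω₁) - 1) + 1) /
              (1 / (Real.exp ((p : ℝ) * β * ω₁) - 1))) =
          (ω₁ / ω₀) * (p : ℝ) * β) := by
  have hp0 : (0 : ℝ) < p := by exact_mod_cast hp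
  have hx : 0 < (p : ℝ) * β * ω₁ := by positivity
  refine ⟨?_, fun _ => ?_⟩
  · have hE : 0 < Real.exp (β * ω₁) - 1 :=
      sub_pos.mpr (Real.one_lt_exp_iff.mpr (mul_pos hβ h1))
    have hF : 0 < Real.exp ((p : ℝ) * β * ω₁) - 1 :=
      sub_pos.mpr (Real.one_lt_exp_iff.mpr hx)
    have hm0 : 0 < m := by rw [hm]; positivity
    have hm1 : 1 + m = Real.exp (β * ω₁) * m := by
      rw [hm]
      field_simp
      ring
    have hpow : (1 + m) ^ p = Real.exp ((p : ℝ) * β * ω₁) * m ^ p := by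
      rw [hm1, mul_pow, ← Real.exp_nat_mul, mul_assoc]
    have hgap : 0 < (1 + m) ^ p - m ^ p := by
      rw [hpow]
      nlinarith [mul_pos hF (pow_pos hm0 p)]
    have hfix : ((1 + m) ^ p - m ^ p) * (1 / (Real.exp ((p : ℝ) * β * ω₁) - 1)) = m ^ p := by
      rw [hpow]
      field_simp
    refine tendsto_of_sub_succ_eq_mul_sub (r := 1 - κ * ((1 + m) ^ p - m ^ p)) ?_ fun n => ?_
    · rw [abs_lt]
      constructor <;> linarith [mul_pos hκ hgap]
    · have h := hrec (n + 1) n.succ_pos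
      rw [Nat.add_sub_cancel] at h
      linear_combination h - κ * hfix
  · rw [log_one_div_exp_sub_one_add_one_div hx]
    ring
end

section
/- Let g₀ > 0 and g_N > 0 be reals and define constants B = (1/2)·ln(tanh(g₀/4)) and A = (1/2)·ln(tanh(g_N/4)) − B. Define g : ℝ → ℝ on an open interval containing [0,1] by g(t) = 2·ln( −coth( A·t + B ) ) (note A·t + B < 0 for t ∈ [0,1], so −coth(A·t+B) > 1 and g(t) > 0). Then g is twice differentiable there and satisfies the differential equation g″(t) = (g′(t))² · (e^{g(t)} + 1) / ( 2·(e^{g(t)} − 1) ) for all t in the interval, with boundary values g(0) = g₀ and g(1) = g_N. -/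
/-- The hyperbolic cotangent. -/
noncomputable def coth (x : ℝ) : ℝ := Real.cosh x / Real.sinh x

theorem tanh_quarter_mem_Ioo {x : ℝ} (hx : 0 < x) : Real.tanh (x / 4) ∈ Set.Ioo (0 : ℝ) 1 := by
  have hs : 0 < Real.sinh (x / 4) := Real.sinh_pos_iff.2 (by positivity)
  have hc := Real.cosh_pos (x / 4)
  rw [Real.tanh_eq_sinh_div_cosh]
  exact ⟨div_pos hs hc, (div_lt_one hc).2 (Real.sinh_lt_cosh _)⟩

theorem half_log_tanh_quarter_neg {x : ℝ} (hx : 0 < x) :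
    (1 / 2) * Real.log (Real.tanh (x / 4)) < 0 := by
  have h := tanh_quarter_mem_Ioo hx
  linarith [Real.log_neg h.1 h.2]

theorem neg_coth_half_log {T : ℝ} (hT : T ∈ Set.Ioo (0 : ℝ) 1) :
    -coth ((1 / 2) * Real.log T) = (1 + T) / (1 - T) := by
  set E := Real.exp ((1 / 2) * Real.log T) with hE
  have hE0 : 0 < E := Real.exp_pos _
  have hET : T = E ^ 2 := by
    rw [hE, ← Real.exp_nat_mul]
    push_cast
    rw [← mul_assoc]
    norm_num
    rw [Real.exp_log hT.1]
  have h1 : 1 - E ^ 2 ≠ 0 := by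
    have := hT.2
    rw [hET] at this
    linarith
  have h2 : E ^ 2 - 1 ≠ 0 := fun h => h1 (by linarith)
  have h3 : E - E⁻¹ ≠ 0 := by
    intro h
    apply h2
    field_simp at h
    simpa using h
  rw [coth, Real.cosh_eq, Real.sinh_eq, Real.exp_neg, ← hE, hET, ← neg_div,
    div_eq_div_iff (by positivity) h1]
  field_simp
  ring

theorem two_mul_log_neg_coth_half_log_tanh {x : ℝ} (hx : 0 < x) :
    2 * Real.log (-coth ((1 / 2) * Real.log (Real.tanh (x / 4)))) = x := by
  have hT := tanh_quarter_mem_Ioo hx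
  have hc := Real.cosh_pos (x / 4)
  have h : (1 + Real.tanh (x / 4)) / (1 - Real.tanh (x / 4)) = Real.exp (x / 2) := by
    rw [div_eq_iff (sub_pos.2 hT.2).ne', Real.tanh_eq_sinh_div_cosh]
    have e1 := Real.cosh_add_sinh (x / 4)
    have e2 := Real.cosh_sub_sinh (x / 4)
    have e3 : Real.exp (x / 2) * Real.exp (-(x / 4)) = Real.exp (x / 4) := by
      rw [← Real.exp_add]
      ring_nf
    rw [← e1, ← e2] at e3
    field_simp
    linarith
  rw [neg_coth_half_log hT, h, Real.log_exp]
  ring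

theorem neg_coth_pos {u : ℝ} (hu : u < 0) : 0 < -coth u := by
  rw [coth, ← div_neg]
  exact div_pos (Real.cosh_pos u) (neg_pos.2 (Real.sinh_neg_iff.2 hu))

theorem hasDerivAt_two_mul_log_neg_coth {A B t : ℝ} (hu : A * t + B < 0) :
    HasDerivAt (fun t => 2 * Real.log (-coth (A * t + B)))
      (-(2 * A) / (Real.sinh (A * t + B) * Real.cosh (A * t + B))) t := by
  have hs : Real.sinh (A * t + B) ≠ 0 := (Real.sinh_neg_iff.2 hu).ne
  have hc : Real.cosh (A * t + B) ≠ 0 := (Real.cosh_pos _).ne'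
  have hlin : HasDerivAt (fun t => A * t + B) A t := by
    simpa using ((hasDerivAt_id t).const_mul A).add_const B
  have h := (((hlin.cosh.div hlin.sinh hs).neg).log (neg_coth_pos hu).ne').const_mul 2
  refine h.congr_deriv ?_
  have hsq := Real.cosh_sq (A * t + B)
  simp only [Pi.neg_apply, Pi.div_apply]
  field_simp
  linear_combination -A * hsq

theorem hasDerivAt_div_sinh_mul_cosh {A B t : ℝ} (hu : A * t + B < 0) :
    HasDerivAt (fun t => -(2 * A) / (Real.sinh (A * t + B) * Real.cosh (A * t + B)))
      (2 * A ^ 2 * (Real.cosh (A * t + B) ^ 2 + Real.sinh (A * t + B) ^ 2) /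
        (Real.sinh (A * t + B) * Real.cosh (A * t + B)) ^ 2) t := by
  have hs : Real.sinh (A * t + B) ≠ 0 := (Real.sinh_neg_iff.2 hu).ne
  have hc : Real.cosh (A * t + B) ≠ 0 := (Real.cosh_pos _).ne'
  have hlin : HasDerivAt (fun t => A * t + B) A t := by
    simpa using ((hasDerivAt_id t).const_mul A).add_const B
  have h := (hasDerivAt_const t (-(2 * A))).div (hlin.sinh.mul hlin.cosh) (mul_ne_zero hs hc)
  refine h.congr_deriv ?_
  simp only [Pi.mul_apply]
  field_simp
  ring

/-- The continuum-limit optimal machine spectrum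
`g(t) = 2·ln(−coth(A·t + B))` with `B = ½·ln(tanh(g₀/4))` and
`A = ½·ln(tanh(g_N/4)) − B` is, on an open interval containing `[0,1]`, twice
differentiable and satisfies the Euler–Lagrange equation
`g″ = (g′)²·(e^g + 1)/(2(e^g − 1))`, with boundary values `g(0) = g₀` and `g(1) = g_N`. -/
theorem optimal_spectrum_ODE (g₀ gN : ℝ) (hg₀ : 0 < g₀) (hgN : 0 < gN)
    (B A : ℝ) (hB : B = (1 / 2) * Real.log (Real.tanh (g₀ / 4)))
    (hA : A = (1 / 2) * Real.log (Real.tanh (gN / 4)) - B)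
    (g : ℝ → ℝ) (hg : ∀ t, g t = 2 * Real.log (-coth (A * t + B))) :
    ∃ U : Set ℝ, IsOpen U ∧ Set.Icc (0 : ℝ) 1 ⊆ U ∧
      (∀ t ∈ U, DifferentiableAt ℝ g t ∧ DifferentiableAt ℝ (deriv g) t ∧
        deriv (deriv g) t =
          (deriv g t) ^ 2 * (Real.exp (g t) + 1) / (2 * (Real.exp (g t) - 1))) ∧
      g 0 = g₀ ∧ g 1 = gN := by
  obtain rfl : g = fun t => 2 * Real.log (-coth (A * t + B)) := funext hg
  have hB0 : B < 0 := hB ▸ half_log_tanh_quarter_neg hg₀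
  have hAB : A + B = (1 / 2) * Real.log (Real.tanh (gN / 4)) := by rw [hA]; ring
  have hAB0 : A + B < 0 := hAB ▸ half_log_tanh_quarter_neg hgN
  have hU : IsOpen {t : ℝ | A * t + B < 0} :=
    isOpen_lt (by fun_prop) continuous_const
  refine ⟨{t | A * t + B < 0}, hU, ?_, ?_, ?_, ?_⟩
  · rintro t ⟨h0, h1⟩
    change A * t + B < 0
    rcases le_total A 0 with h | h <;> nlinarith
  · intro t ht
    have hd := hasDerivAt_two_mul_log_neg_coth ht
    have hd2 := (hasDerivAt_div_sinh_mul_cosh ht).congr_of_eventuallyEq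
      (Filter.mem_of_superset (hU.mem_nhds ht)
        fun s hs => (hasDerivAt_two_mul_log_neg_coth hs).deriv)
    refine ⟨hd.differentiableAt, hd2.differentiableAt, ?_⟩
    have hs : Real.sinh (A * t + B) ≠ 0 := (Real.sinh_neg_iff.2 ht).ne
    have hc : Real.cosh (A * t + B) ≠ 0 := (Real.cosh_pos _).ne'
    have hsq := Real.cosh_sq (A * t + B)
    have hexp : Real.exp (2 * Real.log (-coth (A * t + B))) = coth (A * t + B) ^ 2 := by
      rw [two_mul, Real.exp_add, Real.exp_log (neg_coth_pos ht)]
      ring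
    have hden : coth (A * t + B) ^ 2 - 1 = 1 / Real.sinh (A * t + B) ^ 2 := by
      rw [coth]
      field_simp
      linarith
    rw [hd2.deriv, hd.deriv, hexp, hden, coth]
    field_simp
  · simpa [hB] using two_mul_log_neg_coth_half_log_tanh hg₀
  · simpa [hAB] using two_mul_log_neg_coth_half_log_tanh hgN
end

section
/- Let g₋, g, g₊ > 0 be reals, set x₋ = 1/(e^{g₋} − 1), x = 1/(e^{g} − 1), x₊ = 1/(e^{g₊} − 1), and define D(a,b) = (a+1)·ln((b+1)/(a+1)) + a·ln(a/b) for a, b > 0. Then the derivative with respect to x of the function x ↦ D(x₋, x) + D(x, x₊) vanishes if and only if g₊ − g = (e^{g − g₋} − 1) · (1 − e^{−g}) / (1 − e^{−g₋}). -/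
/-- Derivative of the geometric relative entropy in its second argument. -/
theorem hasDerivAt_geometricRelEntropy_right {a y : ℝ} (ha : 0 < a) (hy : 0 < y) :
    HasDerivAt (fun y : ℝ => (a + 1) * Real.log ((y + 1) / (a + 1)) + a * Real.log (a / y))
      ((a + 1) / (y + 1) - a / y) y := by
  have h₁ : HasDerivAt (fun y : ℝ => (y + 1) / (a + 1)) (1 / (a + 1)) y :=
    ((hasDerivAt_id y).add_const 1).div_const (a + 1)
  have h₂ : HasDerivAt (fun y : ℝ => a / y) (a * -(y ^ 2)⁻¹) y :=
    (hasDerivAt_inv hy.ne').const_mul a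
  refine (((h₁.log (by positivity)).const_mul (a + 1)).add
    ((h₂.log (by positivity)).const_mul a)).congr_deriv ?_
  field_simp
  ring

/-- Derivative of the geometric relative entropy in its first argument. -/
theorem hasDerivAt_geometricRelEntropy_left {b y : ℝ} (hb : 0 < b) (hy : 0 < y) :
    HasDerivAt (fun y : ℝ => (y + 1) * Real.log ((b + 1) / (y + 1)) + y * Real.log (y / b))
      (Real.log ((b + 1) / b) - Real.log ((y + 1) / y)) y := by
  have h₀ : HasDerivAt (fun y : ℝ => y + 1) 1 y := (hasDerivAt_id y).add_const 1
  have h₁ : HasDerivAt (fun y : ℝ => (b + 1) / (y + 1)) ((b + 1) * (-1 / (y + 1) ^ 2)) y :=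
    (h₀.fun_inv (by positivity)).const_mul (b + 1)
  have h₂ : HasDerivAt (fun y : ℝ => y / b) (1 / b) y := (hasDerivAt_id y).div_const b
  refine ((h₀.mul (h₁.log (by positivity))).add
    ((hasDerivAt_id y).mul (h₂.log (by positivity)))).congr_deriv ?_
  have hy₁ : y + 1 ≠ 0 := by positivity
  have hb₁ : b + 1 ≠ 0 := by positivity
  rw [Real.log_div hb₁ hy₁, Real.log_div hy.ne' hb.ne', Real.log_div hb₁ hb.ne',
    Real.log_div hy₁ hy.ne']
  simp only [id]
  field_simp
  ring

/-- The energy gap is recovered from the Gibbs mean excitation number. -/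
theorem log_gibbsMean_add_one_div {g : ℝ} (hg : 0 < g) :
    Real.log ((1 / (Real.exp g - 1) + 1) / (1 / (Real.exp g - 1))) = g := by
  have h : Real.exp g - 1 ≠ 0 := (sub_pos.2 (Real.one_lt_exp_iff.2 hg)).ne'
  have h' : (1 / (Real.exp g - 1) + 1) / (1 / (Real.exp g - 1)) = Real.exp g := by
    field_simp
    ring
  rw [h', Real.log_exp]


/-- Stationarity condition for the optimal machine spectrum: with
`xm = 1/(e^{gm} − 1)`, `x = 1/(e^g − 1)`, `xp = 1/(e^{gp} − 1)` and relative entropy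
`D(a,b) = (a+1)·ln((b+1)/(a+1)) + a·ln(a/b)` between geometric distributions, the
derivative at `x` of `y ↦ D(xm, y) + D(y, xp)` vanishes if and only if
`gp − g = (e^{g−gm} − 1)·(1 − e^{−g})/(1 − e^{−gm})`. -/
theorem stationarity_condition (gm g gp : ℝ) (hm2 : 0 < gm) (hg : 0 < g) (hp2 : 0 < gp)
    (xm x xp : ℝ) (hxm : xm = 1 / (Real.exp gm - 1)) (hx : x = 1 / (Real.exp g - 1))
    (hxp : xp = 1 / (Real.exp gp - 1)) :
    deriv (fun y : ℝ =>
        ((xm + 1) * Real.log ((y + 1) / (xm + 1)) + xm * Real.log (xm / y)) +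
          ((y + 1) * Real.log ((xp + 1) / (y + 1)) + y * Real.log (y / xp))) x = 0 ↔
      gp - g = (Real.exp (g - gm) - 1) * (1 - Real.exp (-g)) / (1 - Real.exp (-gm)) := by
  have hM : 0 < Real.exp gm - 1 := sub_pos.2 (Real.one_lt_exp_iff.2 hm2)
  have hE : 0 < Real.exp g - 1 := sub_pos.2 (Real.one_lt_exp_iff.2 hg)
  have hP : 0 < Real.exp gp - 1 := sub_pos.2 (Real.one_lt_exp_iff.2 hp2)
  have hxm0 : 0 < xm := hxm ▸ one_div_pos.2 hM
  have hx0 : 0 < x := hx ▸ one_div_pos.2 hE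
  have hxp0 : 0 < xp := hxp ▸ one_div_pos.2 hP
  have hD := ((hasDerivAt_geometricRelEntropy_right hxm0 hx0).fun_add
    (hasDerivAt_geometricRelEntropy_left hxp0 hx0)).deriv
  have key : (xm + 1) / (x + 1) - xm / x =
      -((Real.exp (g - gm) - 1) * (1 - Real.exp (-g)) / (1 - Real.exp (-gm))) := by
    rw [hxm, hx, Real.exp_sub, Real.exp_neg, Real.exp_neg]
    have hE₀ := Real.exp_pos g
    have hM₀ := Real.exp_pos gm
    generalize Real.exp g = E at *
    generalize Real.exp gm = M at *
    have h₁ : 1 / (E - 1) + 1 = E / (E - 1) := by field_simp; ring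
    have h₂ : 1 / (M - 1) + 1 = M / (M - 1) := by field_simp; ring
    have h₃ : 1 - M⁻¹ = (M - 1) / M := by field_simp
    rw [h₁, h₂, h₃]
    field_simp
    ring
  have hlog : Real.log ((xp + 1) / xp) - Real.log ((x + 1) / x) = gp - g := by
    rw [hxp, hx, log_gibbsMean_add_one_div hp2, log_gibbsMean_add_one_div hg]
  rw [hD, key, hlog, neg_add_eq_zero, eq_comm]
end

section
/- Let J be a positive integer and let C, S be J×J complex matrices satisfying C·Cᴴ − conj(S·Sᴴ) = I and (S·Cᴴ)ᵀ = S·Cᴴ. Then there exist J×J unitary matrices W and V and real diagonal matrices Λ_C and Λ_S with nonnegative entries satisfying Λ_C² − Λ_S² = I, such that C = conj(W)·Λ_C·Vᴴ and S = W·Λ_S·Vᴴ. -/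
open Matrix

open scoped InnerProductSpace ComplexOrder

/-- A conjugate-linear map `A` with `⟪x, A y⟫ = ⟪y, A x⟫` on a nontrivial finite-dimensional complex
inner product space has a unit coneigenvector with nonnegative coneigenvalue. -/
theorem exists_unit_coneigenvector {E : Type*} [NormedAddCommGroup E] [InnerProductSpace ℂ E]
    [FiniteDimensional ℂ E] [Nontrivial E] (A : E →ₛₗ[starRingEnd ℂ] E)
    (hA : ∀ x y, ⟪x, A y⟫_ℂ = ⟪y, A x⟫_ℂ) :
    ∃ (v : E) (σ : ℝ), ‖v‖ = 1 ∧ 0 ≤ σ ∧ A v = (σ : ℂ) • v := by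
  suffices h : ∃ (v : E) (σ : ℝ), v ≠ 0 ∧ 0 ≤ σ ∧ A v = (σ : ℂ) • v by
    obtain ⟨v, σ, hv, hσ, h⟩ := h
    refine ⟨((‖v‖⁻¹ : ℝ) : ℂ) • v, σ, ?_, hσ, ?_⟩
    · rw [norm_smul, Complex.norm_real, norm_inv, norm_norm, inv_mul_cancel₀ (norm_ne_zero_iff.2 hv)]
    · rw [A.map_smulₛₗ, h, Complex.conj_ofReal, smul_comm]
  let B : Module.End ℂ E := A.comp A
  obtain ⟨μ, hμ⟩ := Module.End.exists_eigenvalue B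
  obtain ⟨v, hv⟩ := hμ.exists_hasEigenvector
  have hv0 : v ≠ 0 := hv.2
  have hB : A (A v) = μ • v := hv.apply_eq_smul
  obtain ⟨σ, hσ, hμσ⟩ : ∃ σ : ℝ, 0 ≤ σ ∧ μ = (σ : ℂ) * σ := by
    refine ⟨‖A v‖ / ‖v‖, by positivity, ?_⟩
    have h := hA v (A v)
    rw [hB, inner_smul_right, inner_self_eq_norm_sq_to_K, inner_self_eq_norm_sq_to_K] at h
    have hn : ((‖v‖ : ℝ) : ℂ) ≠ 0 := by exact_mod_cast norm_ne_zero_iff.2 hv0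
    push_cast
    field_simp
    simpa using h
  by_cases hu : A v + (σ : ℂ) • v = 0
  · refine ⟨Complex.I • v, σ, smul_ne_zero Complex.I_ne_zero hv0, hσ, ?_⟩
    rw [A.map_smulₛₗ, eq_neg_of_add_eq_zero_left hu, Complex.conj_I, neg_smul_neg, smul_comm]
  · refine ⟨A v + (σ : ℂ) • v, σ, hu, hσ, ?_⟩
    rw [map_add, A.map_smulₛₗ, hB, hμσ, Complex.conj_ofReal, smul_add, smul_smul, add_comm]

/-- Takagi factorization, for conjugate-linear maps: a conjugate-linear map `A` with
`⟪x, A y⟫ = ⟪y, A x⟫` has an orthonormal basis of coneigenvectors with nonnegative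
coneigenvalues. -/
theorem exists_orthonormalBasis_coneigenvectors (n : ℕ) {E : Type*} [NormedAddCommGroup E]
    [InnerProductSpace ℂ E] [FiniteDimensional ℂ E] (hn : Module.finrank ℂ E = n)
    (A : E →ₛₗ[starRingEnd ℂ] E) (hA : ∀ x y, ⟪x, A y⟫_ℂ = ⟪y, A x⟫_ℂ) :
    ∃ (b : OrthonormalBasis (Fin n) ℂ E) (σ : Fin n → ℝ),
      ∀ i, 0 ≤ σ i ∧ A (b i) = (σ i : ℂ) • b i := by
  induction n generalizing E with
  | zero =>
    exact ⟨(stdOrthonormalBasis ℂ E).reindex (finCongr hn), fun _ => 0, fun i => i.elim0⟩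
  | succ n ih =>
    have : Nontrivial E := Module.nontrivial_of_finrank_pos (R := ℂ) (by omega)
    obtain ⟨v, s, hv, hs, hAv⟩ := exists_unit_coneigenvector A hA
    have hv0 : v ≠ 0 := by
      rintro rfl
      simp at hv
    have : Fact (Module.finrank ℂ E = n + 1) := ⟨hn⟩
    have hinv : ∀ x ∈ (ℂ ∙ v)ᗮ, A x ∈ (ℂ ∙ v)ᗮ := by
      intro x hx
      rw [Submodule.mem_orthogonal_singleton_iff_inner_right] at hx ⊢
      rw [hA, hAv, inner_smul_right, inner_eq_zero_symm.1 hx, mul_zero]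
    let A' : (ℂ ∙ v)ᗮ →ₛₗ[starRingEnd ℂ] (ℂ ∙ v)ᗮ :=
      (A.comp (ℂ ∙ v)ᗮ.subtype).codRestrict (ℂ ∙ v)ᗮ fun x => hinv x x.2
    obtain ⟨b, σ, hb⟩ := ih (Submodule.finrank_orthogonal_span_singleton hv0) A' fun x y => hA x y
    have hvb : ∀ i, ⟪v, (b i : E)⟫_ℂ = 0 := fun i =>
      Submodule.mem_orthogonal_singleton_iff_inner_right.1 (b i).2
    let f : Fin (n + 1) → E := Fin.cons v fun i => (b i : E)
    have hf : Orthonormal ℂ f := by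
      have hbi := orthonormal_iff_ite.1 b.orthonormal
      rw [orthonormal_iff_ite]
      intro i j
      refine Fin.cases ?_ (fun i => ?_) i <;> refine Fin.cases ?_ (fun j => ?_) j
      · simp [f, inner_self_eq_norm_sq_to_K, hv]
      · simp [f, hvb, (Fin.succ_ne_zero j).symm]
      · simp [f, inner_eq_zero_symm.1 (hvb i), Fin.succ_ne_zero i]
      · simpa [f] using hbi i j
    have hcard : Fintype.card (Fin (n + 1)) = Module.finrank ℂ E := by simp [hn]
    let e := (basisOfOrthonormalOfCardEqFinrank hf hcard).toOrthonormalBasis (by simpa using hf)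
    have he : ∀ i, e i = f i := fun i => by simp [e]
    refine ⟨e, Fin.cons s σ, fun i => ?_⟩
    rw [he]
    refine Fin.cases ?_ (fun i => ?_) i
    · exact ⟨hs, hAv⟩
    · exact ⟨(hb i).1, congrArg Subtype.val (hb i).2⟩

namespace Matrix

variable {n : Type*} [Fintype n] [DecidableEq n]

theorem map_starRingEnd_eq {m n : Type*} (A : Matrix m n ℂ) : A.map (starRingEnd ℂ) = Aᴴᵀ :=
  rfl

theorem conjTranspose_transpose_comm {m n : Type*} (A : Matrix m n ℂ) : Aᵀᴴ = Aᴴᵀ :=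
  rfl

/-- Takagi factorization of a complex symmetric matrix. -/
theorem exists_takagi {m : ℕ} (M : Matrix (Fin m) (Fin m) ℂ) (hM : Mᵀ = M) :
    ∃ (W : Matrix (Fin m) (Fin m) ℂ) (σ : Fin m → ℝ), W ∈ unitaryGroup (Fin m) ℂ ∧
      (∀ j, 0 ≤ σ j) ∧ M = W * diagonal (fun j => (σ j : ℂ)) * Wᵀ := by
  let A : EuclideanSpace ℂ (Fin m) →ₛₗ[starRingEnd ℂ] EuclideanSpace ℂ (Fin m) :=
    { toFun := fun v => WithLp.toLp 2 (M *ᵥ star v.ofLp)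
      map_add' := fun x y => by simp [mulVec_add]
      map_smul' := fun c x => by simp [mulVec_smul] }
  have hA : ∀ x y, ⟪x, A y⟫_ℂ = ⟪y, A x⟫_ℂ := by
    intro x y
    simp only [EuclideanSpace.inner_eq_star_dotProduct, A, LinearMap.coe_mk, AddHom.coe_mk]
    rw [dotProduct_comm, dotProduct_mulVec, ← mulVec_transpose, hM]
  obtain ⟨b, σ, hb⟩ := exists_orthonormalBasis_coneigenvectors m (by simp) A hA
  let W : Matrix (Fin m) (Fin m) ℂ := of fun i j => b j i
  have hW : Wᴴ * W = 1 := by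
    ext i j
    have h := orthonormal_iff_ite.1 b.orthonormal i j
    rw [EuclideanSpace.inner_eq_star_dotProduct, dotProduct_comm] at h
    simpa [mul_apply, W, one_apply, dotProduct] using h
  have hW' : Wᴴᵀ * Wᵀ = 1 := by
    rw [← transpose_mul, mul_eq_one_comm.1 hW, transpose_one]
  have hMW : M * Wᴴᵀ = W * diagonal (fun j => (σ j : ℂ)) := by
    ext i j
    have h := congrArg (fun v : EuclideanSpace ℂ (Fin m) => v i) (hb j).2
    rw [mul_diagonal]
    simpa [A, mulVec, dotProduct, mul_apply, W, mul_comm] using h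
  refine ⟨W, σ, mem_unitaryGroup_iff'.2 hW, fun j => (hb j).1, ?_⟩
  rw [← hMW, Matrix.mul_assoc, hW', Matrix.mul_one]

/-- A positive semidefinite matrix `Y` is determined by `Y² + Y` when the latter is diagonal. -/
theorem PosSemidef.eq_diagonal_of_sq_add_self {Y : Matrix n n ℂ} (hY : Y.PosSemidef)
    {l : n → ℝ} (hl : ∀ j, 0 ≤ l j)
    (h : Y * Y + Y = diagonal (fun j => ((l j ^ 2 + l j : ℝ) : ℂ))) :
    Y = diagonal (fun j => (l j : ℂ)) := by
  set L : Matrix n n ℂ := diagonal (fun j => (l j : ℂ)) with hL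
  have hLL : L * L + L = diagonal (fun j => ((l j ^ 2 + l j : ℝ) : ℂ)) := by
    simp [hL, diagonal_mul_diagonal, diagonal_add, sq]
  have hcomm : Y * L = L * Y := by
    have hD : Y * (Y * Y + Y) = (Y * Y + Y) * Y := by noncomm_ring
    rw [h] at hD
    ext i j
    have hij := congrFun (congrFun hD i) j
    rw [mul_diagonal, diagonal_mul, mul_comm] at hij
    rw [hL, mul_diagonal, diagonal_mul, mul_comm]
    rcases eq_or_ne (Y i j) 0 with h0 | h0
    · simp [h0]
    · have hd : l j ^ 2 + l j = l i ^ 2 + l i := by exact_mod_cast mul_right_cancel₀ h0 hij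
      have : l j = l i := by nlinarith [hl i, hl j, sq_nonneg (l i - l j)]
      rw [this]
  have hLp : L.PosSemidef := PosSemidef.diagonal fun j => by simpa using hl j
  have hu : IsUnit (Y + L + 1) := (PosDef.posSemidef_add (hY.add hLp) PosDef.one).isUnit
  have hz : (Y - L) * (Y + L + 1) = 0 := by
    have : (Y - L) * (Y + L + 1) = (Y * Y + Y) - (L * L + L) + (Y * L - L * Y) := by noncomm_ring
    rw [this, h, hLL, hcomm]
    simp
  exact sub_eq_zero.1 (hu.mul_left_eq_zero.1 hz)

/-- The second normalization of a Bogoliubov pair `(C, S)`. -/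
theorem conjTranspose_mul_self_of_bogoliubov {C S : Matrix n n ℂ}
    (h1 : C * Cᴴ - (S * Sᴴ).map (starRingEnd ℂ) = 1) (h2 : (S * Cᴴ)ᵀ = S * Cᴴ) :
    Cᴴ * C = 1 + Sᴴ * S := by
  have e1 : C * Cᴴ - Sᴴᵀ * Sᵀ = 1 := by
    rw [← h1, map_starRingEnd_eq, conjTranspose_mul, conjTranspose_conjTranspose, transpose_mul]
  have e2 : Cᴴᵀ * Sᵀ = S * Cᴴ := by rw [← transpose_mul, h2]
  have e3 : Sᴴᵀ * Cᵀ = C * Sᴴ := by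
    have := congrArg conjTranspose e2
    rwa [conjTranspose_mul, conjTranspose_mul, conjTranspose_conjTranspose,
      conjTranspose_transpose_comm, conjTranspose_transpose_comm,
      conjTranspose_conjTranspose] at this
  have e4 : Cᴴᵀ * Cᵀ - S * Sᴴ = 1 := by
    have := congrArg transpose e1
    rw [transpose_sub, transpose_mul, transpose_mul, transpose_transpose, transpose_transpose,
      transpose_one] at this
    exact this
  have hNK : fromBlocks C Sᴴᵀ S Cᴴᵀ * fromBlocks Cᴴ (-Sᴴ) (-Sᵀ) Cᵀ = 1 := by
    rw [fromBlocks_multiply, ← fromBlocks_one]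
    congr 1
    · rw [Matrix.mul_neg, ← sub_eq_add_neg, e1]
    · rw [Matrix.mul_neg, e3, neg_add_cancel]
    · rw [Matrix.mul_neg, e2, add_neg_cancel]
    · rw [Matrix.mul_neg, neg_add_eq_sub, e4]
  have hKN := mul_eq_one_comm.1 hNK
  rw [fromBlocks_multiply, ← fromBlocks_one] at hKN
  have := (fromBlocks_inj.1 hKN).1
  rw [Matrix.neg_mul, ← sub_eq_add_neg] at this
  exact sub_eq_iff_eq_add.1 this

end Matrix

/-- Bloch–Messiah decomposition of the linear part `(C, S)` of a multimode Gaussian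
(Bogoliubov) unitary: if `C·Cᴴ − conj(S·Sᴴ) = I` and `(S·Cᴴ)ᵀ = S·Cᴴ`, then there are
unitary `W`, `V` and nonnegative real diagonal `Λ_C`, `Λ_S` with `Λ_C² − Λ_S² = I` such
that `C = conj(W)·Λ_C·Vᴴ` and `S = W·Λ_S·Vᴴ`. -/
theorem bloch_messiah (J : ℕ) (hJ : 0 < J) (C S : Matrix (Fin J) (Fin J) ℂ)
    (h1 : C * Cᴴ - (S * Sᴴ).map (starRingEnd ℂ) = 1)
    (h2 : (S * Cᴴ)ᵀ = S * Cᴴ) :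
    ∃ (W V : Matrix (Fin J) (Fin J) ℂ) (ΛC ΛS : Fin J → ℝ),
      W ∈ Matrix.unitaryGroup (Fin J) ℂ ∧ V ∈ Matrix.unitaryGroup (Fin J) ℂ ∧
      (∀ j, 0 ≤ ΛC j) ∧ (∀ j, 0 ≤ ΛS j) ∧ (∀ j, ΛC j ^ 2 - ΛS j ^ 2 = 1) ∧
      C = W.map (starRingEnd ℂ) * Matrix.diagonal (fun j => (ΛC j : ℂ)) * Vᴴ ∧
      S = W * Matrix.diagonal (fun j => (ΛS j : ℂ)) * Vᴴ := by
  obtain ⟨W, σ, hWu, hσ, hM⟩ := exists_takagi (S * Cᴴ) h2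
  have hW : Wᴴ * W = 1 := mem_unitaryGroup_iff'.1 hWu
  have hW' : W * Wᴴ = 1 := mem_unitaryGroup_iff.1 hWu
  have hWt : Wᵀ * Wᴴᵀ = 1 := by rw [← transpose_mul, hW, transpose_one]
  have hWt' : Wᴴᵀ * Wᵀ = 1 := by rw [← transpose_mul, hW', transpose_one]
  have hCC := conjTranspose_mul_self_of_bogoliubov h1 h2
  obtain ⟨l, hl, hlσ⟩ : ∃ l : Fin J → ℝ, (∀ j, 0 ≤ l j) ∧ ∀ j, l j ^ 2 + l j = σ j ^ 2 := by
    refine ⟨fun j => (√(1 + 4 * σ j ^ 2) - 1) / 2, fun j => ?_, fun j => ?_⟩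
    · have : 1 ≤ √(1 + 4 * σ j ^ 2) := Real.one_le_sqrt.2 (by nlinarith [sq_nonneg (σ j)])
      linarith
    · have := Real.sq_sqrt (show 0 ≤ 1 + 4 * σ j ^ 2 by positivity)
      nlinarith
  have hMM : (S * Sᴴ) * (S * Sᴴ) + S * Sᴴ =
      W * diagonal (fun j => ((l j ^ 2 + l j : ℝ) : ℂ)) * Wᴴ := by
    have e1 : (S * Cᴴ) * (S * Cᴴ)ᴴ = (S * Sᴴ) * (S * Sᴴ) + S * Sᴴ := by
      rw [conjTranspose_mul, conjTranspose_conjTranspose,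
        show S * Cᴴ * (C * Sᴴ) = S * (Cᴴ * C) * Sᴴ by simp only [Matrix.mul_assoc], hCC]
      noncomm_ring
    have e2 : (W * diagonal (fun j => (σ j : ℂ)) * Wᵀ)ᴴ =
        Wᴴᵀ * diagonal (fun j => (σ j : ℂ)) * Wᴴ := by
      rw [conjTranspose_mul, conjTranspose_mul, diagonal_conjTranspose, ← Matrix.mul_assoc]
      congr 3
      ext j
      simp
    rw [← e1, hM, e2]
    calc W * diagonal (fun j => (σ j : ℂ)) * Wᵀ * (Wᴴᵀ * diagonal (fun j => (σ j : ℂ)) * Wᴴ)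
        = W * diagonal (fun j => (σ j : ℂ)) * (Wᵀ * Wᴴᵀ) * diagonal (fun j => (σ j : ℂ)) * Wᴴ := by
          simp only [Matrix.mul_assoc]
      _ = W * (diagonal (fun j => (σ j : ℂ)) * diagonal (fun j => (σ j : ℂ))) * Wᴴ := by
          rw [hWt, Matrix.mul_one, Matrix.mul_assoc W]
      _ = _ := by
          rw [diagonal_mul_diagonal]
          congr 3
          ext j
          rw [hlσ]
          push_cast
          ring
  have hSS : S * Sᴴ = W * diagonal (fun j => (l j : ℂ)) * Wᴴ := by
    have hY : Wᴴ * (S * Sᴴ) * W = diagonal (fun j => (l j : ℂ)) := by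
      refine ((posSemidef_self_mul_conjTranspose S).conjTranspose_mul_mul_same W
        ).eq_diagonal_of_sq_add_self hl ?_
      calc Wᴴ * (S * Sᴴ) * W * (Wᴴ * (S * Sᴴ) * W) + Wᴴ * (S * Sᴴ) * W
          = Wᴴ * (S * Sᴴ) * (W * Wᴴ) * (S * Sᴴ) * W + Wᴴ * (S * Sᴴ) * W := by
            simp only [Matrix.mul_assoc]
        _ = Wᴴ * ((S * Sᴴ) * (S * Sᴴ) + S * Sᴴ) * W := by
            rw [hW']
            noncomm_ring
        _ = (Wᴴ * W) * diagonal (fun j => ((l j ^ 2 + l j : ℝ) : ℂ)) * (Wᴴ * W) := by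
            rw [hMM]
            simp only [Matrix.mul_assoc]
        _ = _ := by rw [hW, Matrix.mul_one, Matrix.one_mul]
    rw [← hY]
    calc S * Sᴴ = (W * Wᴴ) * (S * Sᴴ) * (W * Wᴴ) := by rw [hW', Matrix.mul_one, Matrix.one_mul]
      _ = _ := by simp only [Matrix.mul_assoc]
  have hCCt : C * Cᴴ = Wᴴᵀ * diagonal (fun j => ((1 + l j : ℝ) : ℂ)) * Wᵀ := by
    have hmap : (S * Sᴴ).map (starRingEnd ℂ) = (S * Sᴴ)ᵀ := by
      rw [map_starRingEnd_eq, (isHermitian_mul_conjTranspose_self S).eq]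
    have hadd : diagonal (fun j => ((1 + l j : ℝ) : ℂ)) = 1 + diagonal (fun j => (l j : ℂ)) := by
      rw [← diagonal_one, diagonal_add]
      simp
    rw [sub_eq_iff_eq_add.1 h1, hmap, hSS, transpose_mul, transpose_mul, diagonal_transpose, hadd,
      Matrix.mul_add, Matrix.add_mul, Matrix.mul_one, hWt', Matrix.mul_assoc]
  let c : Fin J → ℝ := fun j => √(1 + l j)
  have hc : ∀ j, 0 < c j := fun j => Real.sqrt_pos.2 (by linarith [hl j])
  have hc2 : ∀ j, c j ^ 2 = 1 + l j := fun j => Real.sq_sqrt (by linarith [hl j])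
  have hs2 : ∀ j, √(l j) ^ 2 = l j := fun j => Real.sq_sqrt (hl j)
  have hcs : ∀ j, √(l j) * c j = σ j := fun j => by
    rw [← Real.sqrt_mul (hl j), ← Real.sqrt_sq (hσ j), ← hlσ]
    ring_nf
  have hcinv : ∀ j, (c j : ℂ) * ((c j)⁻¹ : ℝ) = 1 := fun j => by
    rw [← Complex.ofReal_mul, mul_inv_cancel₀ (hc j).ne', Complex.ofReal_one]
  let Q : Matrix (Fin J) (Fin J) ℂ := diagonal (fun j => (((c j)⁻¹ : ℝ) : ℂ))
  have hQ : Qᴴ = Q := by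
    rw [diagonal_conjTranspose]
    congr 1
    ext j
    simp
  let V : Matrix (Fin J) (Fin J) ℂ := Cᴴ * Wᴴᵀ * Q
  have hV : Vᴴ = Q * Wᵀ * C := by
    have : Wᴴᵀᴴ = Wᵀ := by rw [conjTranspose_transpose_comm, conjTranspose_conjTranspose]
    rw [conjTranspose_mul, conjTranspose_mul, conjTranspose_conjTranspose, hQ, this,
      Matrix.mul_assoc]
  have hVC : Vᴴ * Cᴴ = diagonal (fun j => (c j : ℂ)) * Wᵀ := by
    calc Vᴴ * Cᴴ = Q * Wᵀ * (C * Cᴴ) := by rw [hV, Matrix.mul_assoc]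
      _ = Q * (Wᵀ * Wᴴᵀ) * diagonal (fun j => ((1 + l j : ℝ) : ℂ)) * Wᵀ := by
          rw [hCCt]
          simp only [Matrix.mul_assoc]
      _ = _ := by
          rw [hWt, Matrix.mul_one, diagonal_mul_diagonal]
          congr 2
          ext j
          rw [← hc2, ← Complex.ofReal_mul]
          congr 1
          field_simp [(hc j).ne']
  have hVV : Vᴴ * V = 1 := by
    calc Vᴴ * V = Vᴴ * Cᴴ * Wᴴᵀ * Q := by simp only [V, Matrix.mul_assoc]
      _ = diagonal (fun j => (c j : ℂ)) * (Wᵀ * Wᴴᵀ) * Q := by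
          rw [hVC]
          simp only [Matrix.mul_assoc]
      _ = 1 := by
          rw [hWt, Matrix.mul_one, diagonal_mul_diagonal, ← diagonal_one]
          congr 1
          exact funext hcinv
  have hC : C = Wᴴᵀ * diagonal (fun j => (c j : ℂ)) * Vᴴ := by
    have h : diagonal (fun j => (c j : ℂ)) * Q = 1 := by
      rw [diagonal_mul_diagonal, ← diagonal_one]
      congr 1
      exact funext hcinv
    calc C = Wᴴᵀ * (diagonal (fun j => (c j : ℂ)) * Q) * Wᵀ * C := by
          rw [h, Matrix.mul_one, hWt', Matrix.one_mul]
      _ = _ := by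
          rw [hV]
          simp only [Matrix.mul_assoc]
  have hS : S = W * diagonal (fun j => ((√(l j) : ℝ) : ℂ)) * Vᴴ := by
    have hu : IsUnit Cᴴ := by
      have : IsUnit (Cᴴ * C) := by
        rw [hCC]
        exact (PosDef.one.add_posSemidef (posSemidef_conjTranspose_mul_self S)).isUnit
      rw [isUnit_iff_isUnit_det, det_mul] at this
      exact (isUnit_iff_isUnit_det _).2 (isUnit_of_mul_isUnit_left this)
    refine hu.mul_right_cancel ?_
    rw [hM, Matrix.mul_assoc _ Vᴴ, hVC, ← Matrix.mul_assoc _ _ Wᵀ,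
      Matrix.mul_assoc W _ (diagonal fun j => (c j : ℂ)), diagonal_mul_diagonal]
    congr 3
    ext j
    rw [← hcs, Complex.ofReal_mul]
  exact ⟨W, V, c, fun j => √(l j), hWu, mem_unitaryGroup_iff'.2 hVV, fun j => (hc j).le,
    fun j => Real.sqrt_nonneg _, fun j => by rw [hc2, hs2]; ring, hC, hS⟩
end
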